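/- arXiv:2103.14094 — 6 statements merged into one kernel-verified Lean document; each statement's English description precedes it below -/
import Mathlib

section
/- For the quadratic function h(x) = (1/2)‖Ax − b‖² and for all x, t ∈ ℝ^m, the expectation over the random block set I ∼ Π satisfies E_{I∼Π}[ h(x + U_I P t) ] = h(x) + ⟨∇h(x), t⟩ + (1/2)‖t‖²_Σ. -/
open Matrix

/-- `h(x) = (1/2)‖Ax − b‖²` written with the dot product. -/
noncomputable def quadH {m q : ℕ} (A : Matrix (Fin q) (Fin m) ℝ) (b : Fin q → ℝ)
    (x : Fin m → ℝ) : ℝ := (1 / 2) * ((A *ᵥ x - b) ⬝ᵥ (A *ᵥ x - b))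

/-- `∇h(x) = Aᵀ(Ax − b)`. -/
noncomputable def gradH {m q : ℕ} (A : Matrix (Fin q) (Fin m) ℝ) (b : Fin q → ℝ)
    (x : Fin m → ℝ) : Fin m → ℝ := Aᵀ *ᵥ (A *ᵥ x - b)

/-- `‖x‖_M² = ⟨Mx, x⟩`. -/
noncomputable def mNormSq {m : ℕ} (M : Matrix (Fin m) (Fin m) ℝ) (x : Fin m → ℝ) : ℝ :=
  (M *ᵥ x) ⬝ᵥ x

/-- `U_I = Σ_{i∈I} U_i`: the 0/1 diagonal matrix selecting the blocks in `I`. -/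
def blockUSet {m d : ℕ} (blk : Fin m → Fin d) (I : Finset (Fin d)) :
    Matrix (Fin m) (Fin m) ℝ :=
  Matrix.diagonal (fun j => if blk j ∈ I then 1 else 0)

/-- `p_i = Prob_{I∼Π}(i ∈ I)`. -/
noncomputable def pblock {d : ℕ} (Pi : Finset (Fin d) → ℝ) (i : Fin d) : ℝ :=
  ∑ I ∈ Finset.univ.filter (fun I : Finset (Fin d) => i ∈ I), Pi I

/-- `P = diag(p_1⁻¹ Id_{m_1},…,p_d⁻¹ Id_{m_d})`. -/
noncomputable def Pmat {m d : ℕ} (blk : Fin m → Fin d) (Pi : Finset (Fin d) → ℝ) :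
    Matrix (Fin m) (Fin m) ℝ :=
  Matrix.diagonal (fun j => (pblock Pi (blk j))⁻¹)

/-- `Σ = E_{I∼Π}[U_I P AᵀA P U_I]`. -/
noncomputable def SigmaMat {m q d : ℕ} (A : Matrix (Fin q) (Fin m) ℝ)
    (blk : Fin m → Fin d) (Pi : Finset (Fin d) → ℝ) : Matrix (Fin m) (Fin m) ℝ :=
  ∑ I : Finset (Fin d),
    Pi I • (blockUSet blk I * Pmat blk Pi * (Aᵀ * A) * Pmat blk Pi * blockUSet blk I)

/-- Exact second-order expansion of the quadratic `h` around `x`. -/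
theorem quadH_add {m q : ℕ} (A : Matrix (Fin q) (Fin m) ℝ) (b : Fin q → ℝ)
    (x v : Fin m → ℝ) :
    quadH A b (x + v) = quadH A b x + gradH A b x ⬝ᵥ v + (1 / 2) * mNormSq (Aᵀ * A) v := by
  have hsplit : A *ᵥ (x + v) - b = (A *ᵥ x - b) + A *ᵥ v := by
    rw [mulVec_add]; abel
  have hgrad : gradH A b x ⬝ᵥ v = (A *ᵥ x - b) ⬝ᵥ (A *ᵥ v) := by
    rw [gradH, mulVec_transpose, dotProduct_mulVec]
  have hnorm : mNormSq (Aᵀ * A) v = (A *ᵥ v) ⬝ᵥ (A *ᵥ v) := by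
    rw [mNormSq, ← mulVec_mulVec, mulVec_transpose, dotProduct_mulVec]
  rw [hgrad, hnorm, quadH, quadH, hsplit, add_dotProduct, dotProduct_add, dotProduct_add,
    dotProduct_comm (A *ᵥ v) (A *ᵥ x - b)]
  ring

/-- Congruence rule for the quadratic form: `‖Bt‖_M² = ‖t‖_{BᵀMB}²`. -/
theorem mNormSq_mulVec {m : ℕ} (M B : Matrix (Fin m) (Fin m) ℝ) (t : Fin m → ℝ) :
    mNormSq M (B *ᵥ t) = mNormSq (Bᵀ * M * B) t := by
  rw [mNormSq, mNormSq, dotProduct_mulVec, ← mulVec_transpose, mulVec_mulVec, mulVec_mulVec,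
    Matrix.mul_assoc]

/-- `‖t‖_M²` is linear in `M`. -/
theorem mNormSq_sum_smul {m : ℕ} {ι : Type*} (s : Finset ι) (w : ι → ℝ)
    (M : ι → Matrix (Fin m) (Fin m) ℝ) (t : Fin m → ℝ) :
    mNormSq (∑ i ∈ s, w i • M i) t = ∑ i ∈ s, w i * mNormSq (M i) t := by
  simp only [mNormSq, sum_mulVec, sum_dotProduct, smul_mulVec, smul_dotProduct, smul_eq_mul]

/-- The sampling `U_I P` is unbiased: `E[U_I P t] = t`. -/
theorem sum_smul_blockUSet_mul_Pmat_mulVec {m d : ℕ} (blk : Fin m → Fin d)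
    (Pi : Finset (Fin d) → ℝ) (hp : ∀ i, pblock Pi i ≠ 0) (t : Fin m → ℝ) :
    ∑ I : Finset (Fin d), Pi I • ((blockUSet blk I * Pmat blk Pi) *ᵥ t) = t := by
  ext j
  have hcoord : ∀ I : Finset (Fin d), (Pi I • ((blockUSet blk I * Pmat blk Pi) *ᵥ t)) j
      = (if blk j ∈ I then Pi I else 0) * ((pblock Pi (blk j))⁻¹ * t j) := by
    intro I
    simp only [blockUSet, Pmat, diagonal_mul_diagonal, _root_.Pi.smul_apply, mulVec_diagonal, smul_eq_mul]
    split_ifs <;> ring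
  rw [Finset.sum_apply, Finset.sum_congr rfl fun I _ => hcoord I, ← Finset.sum_mul,
    ← Finset.sum_filter, ← pblock, mul_inv_cancel_left₀ (hp _)]

/-- The diagonal matrix `U_I P` is symmetric. -/
theorem transpose_blockUSet_mul_Pmat {m d : ℕ} (blk : Fin m → Fin d)
    (Pi : Finset (Fin d) → ℝ) (I : Finset (Fin d)) :
    (blockUSet blk I * Pmat blk Pi)ᵀ = blockUSet blk I * Pmat blk Pi := by
  rw [blockUSet, Pmat, diagonal_mul_diagonal, diagonal_transpose]

/-- The diagonal matrices `U_I` and `P` commute. -/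
theorem blockUSet_mul_Pmat_comm {m d : ℕ} (blk : Fin m → Fin d)
    (Pi : Finset (Fin d) → ℝ) (I : Finset (Fin d)) :
    blockUSet blk I * Pmat blk Pi = Pmat blk Pi * blockUSet blk I := by
  rw [blockUSet, Pmat, diagonal_mul_diagonal, diagonal_mul_diagonal]
  simp only [mul_comm]

/-- For the quadratic `h(x) = (1/2)‖Ax − b‖²`, the expectation over the random block set
`I ∼ Π` satisfies `E[h(x + U_I P t)] = h(x) + ⟨∇h(x), t⟩ + (1/2)‖t‖²_Σ`. -/
theorem expectation_quadratic_block_perturbation {m q d : ℕ}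
    (A : Matrix (Fin q) (Fin m) ℝ) (b : Fin q → ℝ)
    (blk : Fin m → Fin d) (Pi : Finset (Fin d) → ℝ)
    (hPiNonneg : ∀ I, 0 ≤ Pi I) (hPiSum : ∑ I : Finset (Fin d), Pi I = 1)
    (hpPos : ∀ i, 0 < pblock Pi i)
    (x t : Fin m → ℝ) :
    ∑ I : Finset (Fin d), Pi I * quadH A b (x + (blockUSet blk I * Pmat blk Pi) *ᵥ t)
      = quadH A b x + gradH A b x ⬝ᵥ t + (1 / 2) * mNormSq (SigmaMat A blk Pi) t := by
  have hlin : ∑ I : Finset (Fin d),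
      Pi I * (gradH A b x ⬝ᵥ ((blockUSet blk I * Pmat blk Pi) *ᵥ t)) = gradH A b x ⬝ᵥ t := by
    conv_rhs =>
      rw [← sum_smul_blockUSet_mul_Pmat_mulVec blk Pi (fun i => (hpPos i).ne') t, dotProduct_sum]
    simp only [dotProduct_smul, smul_eq_mul]
  have hquad : ∑ I : Finset (Fin d),
      Pi I * mNormSq (Aᵀ * A) ((blockUSet blk I * Pmat blk Pi) *ᵥ t)
        = mNormSq (SigmaMat A blk Pi) t := by
    rw [SigmaMat, mNormSq_sum_smul]
    refine Finset.sum_congr rfl fun I _ => ?_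
    rw [mNormSq_mulVec, transpose_blockUSet_mul_Pmat,
      Matrix.mul_assoc _ (Pmat blk Pi) (blockUSet blk I), ← blockUSet_mul_Pmat_comm]
  simp only [quadH_add, mul_add, Finset.sum_add_distrib, mul_left_comm _ (1 / 2 : ℝ)]
  rw [← Finset.sum_mul, hPiSum, one_mul, hlin, ← Finset.mul_sum, hquad]
end

section
/- (Expected Separable Overapproximation identity.) For any z, x, x̂ ∈ ℝ^m and any θ ∈ ℝ, the random vector s⁺(I) = z + θ·U_I P (x̂ − x) satisfies E_{I∼Π}[ h(s⁺(I)) ] = h(z) + θ·⟨∇h(z), x̂ − x⟩ + (θ²/2)·‖x̂ − x‖²_Σ. -/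
open Matrix

/-- Exact second-order expansion of the quadratic `quadH` along a direction `w`. -/
theorem quadH_add_smul {m q : ℕ} (A : Matrix (Fin q) (Fin m) ℝ) (b : Fin q → ℝ)
    (z w : Fin m → ℝ) (θ : ℝ) :
    quadH A b (z + θ • w) = quadH A b z + θ * (gradH A b z ⬝ᵥ w)
      + (θ ^ 2 / 2) * ((A *ᵥ w) ⬝ᵥ (A *ᵥ w)) := by
  have hgrad : gradH A b z ⬝ᵥ w = (A *ᵥ z - b) ⬝ᵥ (A *ᵥ w) := by
    rw [gradH, dotProduct_mulVec, mulVec_transpose]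
  have hsplit : A *ᵥ (z + θ • w) - b = (A *ᵥ z - b) + θ • (A *ᵥ w) := by
    rw [mulVec_add, mulVec_smul]
    abel
  rw [hgrad, quadH, quadH, hsplit]
  generalize A *ᵥ z - b = r
  simp only [add_dotProduct, dotProduct_add, smul_dotProduct, dotProduct_smul, smul_eq_mul]
  rw [dotProduct_comm (A *ᵥ w) r]
  ring

theorem Pmat_mul_blockUSet_comm {m d : ℕ} (blk : Fin m → Fin d)
    (Pi : Finset (Fin d) → ℝ) (I : Finset (Fin d)) :
    Pmat blk Pi * blockUSet blk I = blockUSet blk I * Pmat blk Pi := by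
  simp only [Pmat, blockUSet, diagonal_mul_diagonal, mul_comm]

/-- The sampled matrix `U_I P` is the identity in expectation. -/
theorem sum_smul_blockUSet_mul_Pmat {m d : ℕ} (blk : Fin m → Fin d)
    (Pi : Finset (Fin d) → ℝ) (hp : ∀ i, pblock Pi i ≠ 0) :
    ∑ I : Finset (Fin d), Pi I • (blockUSet blk I * Pmat blk Pi) = 1 := by
  ext j k
  rw [Matrix.sum_apply]
  by_cases hjk : j = k
  · subst hjk
    simp only [Pmat, blockUSet, diagonal_mul_diagonal, Matrix.smul_apply, diagonal_apply_eq,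
      smul_eq_mul, one_apply_eq, ← mul_assoc]
    rw [← Finset.sum_mul]
    simp only [mul_ite, mul_one, mul_zero]
    rw [← Finset.sum_filter]
    exact mul_inv_cancel₀ (hp (blk j))
  · simp [Pmat, blockUSet, diagonal_mul_diagonal, hjk]

/-- The `Σ`-seminorm is the expected squared norm of `A U_I P v`. -/
theorem mNormSq_SigmaMat {m q d : ℕ} (A : Matrix (Fin q) (Fin m) ℝ)
    (blk : Fin m → Fin d) (Pi : Finset (Fin d) → ℝ) (v : Fin m → ℝ) :
    mNormSq (SigmaMat A blk Pi) v = ∑ I : Finset (Fin d),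
      Pi I * ((A *ᵥ ((blockUSet blk I * Pmat blk Pi) *ᵥ v)) ⬝ᵥ
        (A *ᵥ ((blockUSet blk I * Pmat blk Pi) *ᵥ v))) := by
  rw [mNormSq, SigmaMat, sum_mulVec, sum_dotProduct]
  refine Finset.sum_congr rfl fun I _ => ?_
  rw [smul_mulVec, smul_dotProduct, smul_eq_mul, Matrix.mul_assoc _ (Pmat blk Pi) (blockUSet blk I),
    Pmat_mul_blockUSet_comm]
  have hT := transpose_blockUSet_mul_Pmat blk Pi I
  generalize blockUSet blk I * Pmat blk Pi = D at hT ⊢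
  have hgram : D * (Aᵀ * A) * D = (A * D)ᵀ * (A * D) := by
    rw [transpose_mul, hT]
    simp only [Matrix.mul_assoc]
  rw [hgram, mulVec_mulVec, dotProduct_mulVec, ← mulVec_transpose, mulVec_mulVec]

/-- Expected Separable Overapproximation identity: for any `z, x, x̂ ∈ ℝ^m` and `θ ∈ ℝ`,
the random vector `s⁺(I) = z + θ·U_I P (x̂ − x)` satisfies
`E[h(s⁺(I))] = h(z) + θ⟨∇h(z), x̂ − x⟩ + (θ²/2)‖x̂ − x‖²_Σ`. -/
theorem eso_identity {m q d : ℕ}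
    (A : Matrix (Fin q) (Fin m) ℝ) (b : Fin q → ℝ)
    (blk : Fin m → Fin d) (Pi : Finset (Fin d) → ℝ)
    (hPiNonneg : ∀ I, 0 ≤ Pi I) (hPiSum : ∑ I : Finset (Fin d), Pi I = 1)
    (hpPos : ∀ i, 0 < pblock Pi i)
    (z x xhat : Fin m → ℝ) (θ : ℝ) :
    ∑ I : Finset (Fin d),
        Pi I * quadH A b (z + θ • ((blockUSet blk I * Pmat blk Pi) *ᵥ (xhat - x)))
      = quadH A b z + θ * (gradH A b z ⬝ᵥ (xhat - x))
        + (θ ^ 2 / 2) * mNormSq (SigmaMat A blk Pi) (xhat - x) := by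
  have hmean : ∑ I : Finset (Fin d),
      Pi I * (gradH A b z ⬝ᵥ ((blockUSet blk I * Pmat blk Pi) *ᵥ (xhat - x)))
        = gradH A b z ⬝ᵥ (xhat - x) := by
    have h := congrArg (fun M => gradH A b z ⬝ᵥ (M *ᵥ (xhat - x)))
      (sum_smul_blockUSet_mul_Pmat blk Pi fun i => (hpPos i).ne')
    simpa only [sum_mulVec, dotProduct_sum, smul_mulVec, dotProduct_smul, smul_eq_mul,
      one_mulVec] using h
  simp only [quadH_add_smul, mul_add, Finset.sum_add_distrib, mul_left_comm (Pi _)]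
  rw [← Finset.mul_sum, ← Finset.mul_sum, ← Finset.sum_mul, hPiSum, hmean,
    ← mNormSq_SigmaMat, one_mul]
end

section
/- Let s, x, x* ∈ ℝ^m, let θ ∈ ℝ with θ ≠ 0, and set z = (1−θ)s + θx. Then ⟨∇h(z), x* − x⟩ = h(x*) + ((1−θ)/θ)·h(s) − (1/θ)·h(z) − (1/2)·‖A(z − x*)‖² − (θ(1−θ)/2)·‖A(x − s)‖². -/
open Matrix

/-- With `z = (1−θ)s + θx` and `θ ≠ 0`,
`⟨∇h(z), x* − x⟩ = h(x*) + ((1−θ)/θ)h(s) − (1/θ)h(z) − (1/2)‖A(z − x*)‖²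
− (θ(1−θ)/2)‖A(x − s)‖²`. -/
theorem gradH_inner_decomposition {m q : ℕ}
    (A : Matrix (Fin q) (Fin m) ℝ) (b : Fin q → ℝ)
    (s x xstar : Fin m → ℝ) (θ : ℝ) (hθ : θ ≠ 0)
    (z : Fin m → ℝ) (hz : z = (1 - θ) • s + θ • x) :
    gradH A b z ⬝ᵥ (xstar - x)
      = quadH A b xstar + ((1 - θ) / θ) * quadH A b s - (1 / θ) * quadH A b z
        - (1 / 2) * ((A *ᵥ (z - xstar)) ⬝ᵥ (A *ᵥ (z - xstar)))
        - (θ * (1 - θ) / 2) * ((A *ᵥ (x - s)) ⬝ᵥ (A *ᵥ (x - s))) := by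
  have hgrad : gradH A b z ⬝ᵥ (xstar - x) = (A *ᵥ z - b) ⬝ᵥ (A *ᵥ xstar - A *ᵥ x) := by
    rw [gradH, mulVec_transpose, ← dotProduct_mulVec, mulVec_sub]
  have hAz : A *ᵥ z = (1 - θ) • (A *ᵥ s) + θ • (A *ᵥ x) := by
    rw [hz, mulVec_add, mulVec_smul, mulVec_smul]
  rw [hgrad]
  simp only [quadH, mulVec_sub, hAz]
  generalize A *ᵥ s = u
  generalize A *ᵥ x = v
  generalize A *ᵥ xstar = w
  simp only [add_dotProduct, dotProduct_add, sub_dotProduct, dotProduct_sub, smul_dotProduct,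
    dotProduct_smul, smul_eq_mul]
  rw [dotProduct_comm v u, dotProduct_comm w u, dotProduct_comm w v, dotProduct_comm b u,
    dotProduct_comm b v, dotProduct_comm b w]
  field_simp
  ring
end

section
/- Let s, x, x* ∈ ℝ^m with Aᵀ(Ax* − b) = 0, let θ ∈ ℝ with θ ≠ 0, and set z = (1−θ)s + θx. Then ⟨∇h(z), x* − x⟩ = ((1−θ)²/θ)·(h(s) − h(x*)) − (1/θ)·(h(z) − h(x*)) − θ·(h(x) − h(x*)). -/
open Matrix

/-- The gradient of `quadH` is affine: at a stationary point `y`, its value at `z` pairs with `v`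
as `⟨A(z − y), Av⟩`. -/
theorem gradH_dotProduct_of_stationary {m q : ℕ} {A : Matrix (Fin q) (Fin m) ℝ} {b : Fin q → ℝ}
    {y : Fin m → ℝ} (hy : Aᵀ *ᵥ (A *ᵥ y - b) = 0) (z v : Fin m → ℝ) :
    gradH A b z ⬝ᵥ v = (A *ᵥ (z - y)) ⬝ᵥ (A *ᵥ v) := by
  have hgrad : gradH A b z = Aᵀ *ᵥ (A *ᵥ (z - y)) := by
    rw [← sub_zero (gradH A b z), ← hy, gradH, ← mulVec_sub, sub_sub_sub_cancel_right, ← mulVec_sub]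
  rw [hgrad, mulVec_transpose, ← dotProduct_mulVec]

/-- Around a stationary point `y`, `quadH` is a pure quadratic form. -/
theorem quadH_sub_of_stationary {m q : ℕ} {A : Matrix (Fin q) (Fin m) ℝ} {b : Fin q → ℝ}
    {y : Fin m → ℝ} (hy : Aᵀ *ᵥ (A *ᵥ y - b) = 0) (z : Fin m → ℝ) :
    quadH A b z - quadH A b y = (1 / 2) * ((A *ᵥ (z - y)) ⬝ᵥ (A *ᵥ (z - y))) := by
  have hortho : (A *ᵥ y - b) ⬝ᵥ (A *ᵥ (z - y)) = 0 := by
    rw [dotProduct_mulVec, ← mulVec_transpose, hy, zero_dotProduct]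
  have hsplit : A *ᵥ z - b = A *ᵥ (z - y) + (A *ᵥ y - b) := by
    rw [mulVec_sub, sub_add_sub_cancel]
  rw [quadH, quadH, hsplit, add_dotProduct, dotProduct_add, dotProduct_add,
    dotProduct_comm (A *ᵥ (z - y)) (A *ᵥ y - b), hortho]
  ring

/-- With `Aᵀ(Ax* − b) = 0`, `θ ≠ 0` and `z = (1−θ)s + θx`,
`⟨∇h(z), x* − x⟩ = ((1−θ)²/θ)(h(s) − h(x*)) − (1/θ)(h(z) − h(x*)) − θ(h(x) − h(x*))`. -/
theorem gradH_inner_decomposition_at_minimizer {m q : ℕ}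
    (A : Matrix (Fin q) (Fin m) ℝ) (b : Fin q → ℝ)
    (s x xstar : Fin m → ℝ)
    (hxstar : Aᵀ *ᵥ (A *ᵥ xstar - b) = 0)
    (θ : ℝ) (hθ : θ ≠ 0)
    (z : Fin m → ℝ) (hz : z = (1 - θ) • s + θ • x) :
    gradH A b z ⬝ᵥ (xstar - x)
      = ((1 - θ) ^ 2 / θ) * (quadH A b s - quadH A b xstar)
        - (1 / θ) * (quadH A b z - quadH A b xstar)
        - θ * (quadH A b x - quadH A b xstar) := by
  have hzx : z - xstar = (1 - θ) • (s - xstar) + θ • (x - xstar) := by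
    rw [hz]
    module
  rw [gradH_dotProduct_of_stationary hxstar, quadH_sub_of_stationary hxstar,
    quadH_sub_of_stationary hxstar, quadH_sub_of_stationary hxstar, hzx, ← neg_sub x xstar]
  simp only [mulVec_add, mulVec_smul, mulVec_neg, add_dotProduct, dotProduct_add, smul_dotProduct,
    dotProduct_smul, dotProduct_neg, smul_eq_mul,
    dotProduct_comm (A *ᵥ (x - xstar)) (A *ᵥ (s - xstar))]
  field_simp
  ring
end

section
/- Let x, x̂, x* ∈ ℝ^m and let x⁺(I) = x + U_I(x̂ − x). Then E_{I∼Π}[ ‖x⁺(I) − x*‖²_{P²T} ] = ‖x̂ − x*‖²_{PT} + ‖x − x*‖²_{P(P−Id)T}. -/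
open Matrix

theorem mNormSq_diagonal_mul {m : ℕ} (c : Fin m → ℝ) (T : Matrix (Fin m) (Fin m) ℝ)
    (x : Fin m → ℝ) :
    mNormSq (Matrix.diagonal c * T) x = ∑ j, ∑ k, c j * T j k * x k * x j := by
  simp [mNormSq, dotProduct, Matrix.mulVec, Finset.sum_mul]

theorem sum_mul_ite_mem {d : ℕ} (Pi : Finset (Fin d) → ℝ)
    (hPiSum : ∑ I : Finset (Fin d), Pi I = 1) (i : Fin d) (a b : ℝ) :
    ∑ I, Pi I * (if i ∈ I then b else a) = pblock Pi i * b + (1 - pblock Pi i) * a := by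
  have h (I : Finset (Fin d)) :
      Pi I * (if i ∈ I then b else a) = (if i ∈ I then Pi I else 0) * (b - a) + Pi I * a := by
    split_ifs <;> ring
  simp only [h, Finset.sum_add_distrib, ← Finset.sum_mul, hPiSum, ← Finset.sum_filter]
  rw [← pblock]
  ring

/-- With `x⁺(I) = x + U_I(x̂ − x)`, one has
`E[‖x⁺(I) − x*‖²_{P²T}] = ‖x̂ − x*‖²_{PT} + ‖x − x*‖²_{P(P−Id)T}`. -/
theorem expected_block_update_distance {m d : ℕ}
    (blk : Fin m → Fin d) (Pi : Finset (Fin d) → ℝ)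
    (hPiNonneg : ∀ I, 0 ≤ Pi I) (hPiSum : ∑ I : Finset (Fin d), Pi I = 1)
    (hpPos : ∀ i, 0 < pblock Pi i)
    (T : Matrix (Fin m) (Fin m) ℝ) (hTpsd : T.PosSemidef)
    (hTblock : ∀ j j' : Fin m, blk j ≠ blk j' → T j j' = 0)
    (x xhat xstar : Fin m → ℝ) :
    ∑ I : Finset (Fin d),
        Pi I * mNormSq (Pmat blk Pi * Pmat blk Pi * T)
          (x + blockUSet blk I *ᵥ (xhat - x) - xstar)
      = mNormSq (Pmat blk Pi * T) (xhat - xstar)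
        + mNormSq (Pmat blk Pi * (Pmat blk Pi - 1) * T) (x - xstar) := by
  have hPP : Pmat blk Pi * Pmat blk Pi =
      Matrix.diagonal (fun j => (pblock Pi (blk j))⁻¹ * (pblock Pi (blk j))⁻¹) :=
    Matrix.diagonal_mul_diagonal _ _
  have hPP1 : Pmat blk Pi * (Pmat blk Pi - 1) =
      Matrix.diagonal (fun j => (pblock Pi (blk j))⁻¹ * ((pblock Pi (blk j))⁻¹ - 1)) := by
    rw [Pmat, ← Matrix.diagonal_one, Matrix.diagonal_sub, Matrix.diagonal_mul_diagonal]
  rw [hPP, hPP1, Pmat]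
  simp only [mNormSq_diagonal_mul, Finset.mul_sum]
  rw [Finset.sum_comm, ← Finset.sum_add_distrib]
  refine Finset.sum_congr rfl fun j _ => ?_
  rw [Finset.sum_comm, ← Finset.sum_add_distrib]
  refine Finset.sum_congr rfl fun k _ => ?_
  by_cases hjk : blk j = blk k
  · set c := (pblock Pi (blk j))⁻¹
    have hterm (I : Finset (Fin d)) :
        Pi I * (c * c * T j k * (x + blockUSet blk I *ᵥ (xhat - x) - xstar) k *
            (x + blockUSet blk I *ᵥ (xhat - x) - xstar) j) =
          Pi I * (if blk j ∈ I then c * c * T j k * (xhat - xstar) k * (xhat - xstar) j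
            else c * c * T j k * (x - xstar) k * (x - xstar) j) := by
      simp only [blockUSet, _root_.Pi.add_apply, _root_.Pi.sub_apply, Matrix.mulVec_diagonal,
        ← hjk]
      split_ifs <;> ring
    have hpc : pblock Pi (blk j) * c = 1 := mul_inv_cancel₀ (hpPos _).ne'
    simp only [hterm, sum_mul_ite_mem Pi hPiSum]
    linear_combination (c * T j k * (xhat - xstar) k * (xhat - xstar) j -
      c * T j k * (x - xstar) k * (x - xstar) j) * hpc
  · simp [hTblock j k hjk]
end

section
/- (Main descent chain.) Let x ∈ dom r, z ∈ ℝ^m, x* ∈ dom r, σ ∈ ℝ, θ > 0, and let x̂ be a minimizer over u ∈ ℝ^m of ⟨∇φ(x) + (σ/θ)∇h(z), u⟩ + r(u) + (1/2)‖u − x‖²_{PT}. Then φ(x̂) ≤ −[ r(x̂) − r(x*) + (1/2)‖x̂ − x*‖²_{PT} ] − (σ/θ)·⟨∇h(z), x̂ − x*⟩ − (1/2)‖x̂ − x‖²_{PT − Λ} + φ(x*) + (1/2)‖x − x*‖²_{PT}. -/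
open Matrix

/-- The continuous linear map `u ↦ v ⬝ᵥ u`, used to express gradients. -/
noncomputable def dotCLM {m : ℕ} (v : Fin m → ℝ) : (Fin m → ℝ) →L[ℝ] ℝ :=
  LinearMap.toContinuousLinearMap
    { toFun := fun u => v ⬝ᵥ u
      map_add' := fun u w => by simp [dotProduct_add]
      map_smul' := fun c u => by simp }

theorem mNormSq_neg {m : ℕ} (M : Matrix (Fin m) (Fin m) ℝ) (u : Fin m → ℝ) :
    mNormSq M (-u) = mNormSq M u := by
  simp [mNormSq, mulVec_neg]

theorem mNormSq_sub_matrix {m : ℕ} (M N : Matrix (Fin m) (Fin m) ℝ) (u : Fin m → ℝ) :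
    mNormSq (M - N) u = mNormSq M u - mNormSq N u := by
  simp [mNormSq, sub_mulVec, sub_dotProduct]

theorem mNormSq_add_smul {m : ℕ} {M : Matrix (Fin m) (Fin m) ℝ} (hM : M.IsSymm)
    (e d : Fin m → ℝ) (t : ℝ) :
    mNormSq M (e + t • d) = mNormSq M e + 2 * t * ((M *ᵥ e) ⬝ᵥ d) + t ^ 2 * mNormSq M d := by
  have h : (M *ᵥ d) ⬝ᵥ e = (M *ᵥ e) ⬝ᵥ d := by
    rw [dotProduct_comm, dotProduct_mulVec, ← mulVec_transpose, hM.eq]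
  simp only [mNormSq, mulVec_add, mulVec_smul, add_dotProduct, dotProduct_add, smul_dotProduct,
    dotProduct_smul, smul_eq_mul, h]
  ring

/-- First-order lower bound for a differentiable convex function. -/
theorem ConvexOn.add_fderiv_le {E : Type*} [NormedAddCommGroup E] [NormedSpace ℝ E]
    {f : E → ℝ} (hf : ConvexOn ℝ Set.univ f) {f' : E →L[ℝ] ℝ} {x : E}
    (hf' : HasFDerivAt f f' x) (y : E) : f x + f' (y - x) ≤ f y := by
  have hconv : ConvexOn ℝ Set.univ (f ∘ AffineMap.lineMap (k := ℝ) x y) :=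
    hf.comp_affineMap _
  have hderiv : HasDerivAt (f ∘ AffineMap.lineMap (k := ℝ) x y) (f' (y - x)) 0 := by
    refine HasFDerivAt.comp_hasDerivAt (0 : ℝ) ?_ AffineMap.hasDerivAt_lineMap
    simpa using hf'
  have h := hconv.le_slope_of_hasDerivAt (Set.mem_univ 0) (Set.mem_univ 1) one_pos hderiv
  simp only [slope_def_field, Function.comp_apply, AffineMap.lineMap_apply_one,
    AffineMap.lineMap_apply_zero, sub_zero, div_one] at h
  linarith

theorem nonneg_of_forall_add_mul_nonneg {a c : ℝ}
    (h : ∀ t : ℝ, 0 < t → t ≤ 1 → 0 ≤ a + t * c) : 0 ≤ a := by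
  have hlim : Filter.Tendsto (fun t : ℝ => a + t * c) (nhdsWithin 0 (Set.Ioi 0)) (nhds a) := by
    have hcont : Continuous fun t : ℝ => a + t * c := by fun_prop
    simpa using (hcont.tendsto 0).mono_left nhdsWithin_le_nhds
  refine ge_of_tendsto hlim ?_
  filter_upwards [Ioc_mem_nhdsGT (one_pos : (0 : ℝ) < 1)] with t ht using h t ht.1 ht.2

/-- Variational inequality at a minimizer of a proximal subproblem. -/
theorem prox_variational_inequality {m : ℕ} {r : (Fin m → ℝ) → EReal}
    (hrConvex : ∀ u v : Fin m → ℝ, ∀ a c : ℝ, 0 ≤ a → 0 ≤ c → a + c = 1 →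
      r (a • u + c • v) ≤ (a : EReal) * r u + (c : EReal) * r v)
    {M : Matrix (Fin m) (Fin m) ℝ} (hM : M.IsSymm) {v x y p : Fin m → ℝ} {ρ ρp : ℝ}
    (hy : r y = ρ) (hp : r p = ρp)
    (hmin : ∀ u : Fin m → ℝ,
      ((v ⬝ᵥ p + (1 / 2) * mNormSq M (p - x) : ℝ) : EReal) + r p
        ≤ ((v ⬝ᵥ u + (1 / 2) * mNormSq M (u - x) : ℝ) : EReal) + r u) :
    0 ≤ v ⬝ᵥ (y - p) + (M *ᵥ (p - x)) ⬝ᵥ (y - p) + ρ - ρp := by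
  refine nonneg_of_forall_add_mul_nonneg (c := (1 / 2) * mNormSq M (y - p)) fun t ht ht1 => ?_
  have hu : (1 - t) • p + t • y = p + t • (y - p) := by module
  have hux : p + t • (y - p) - x = (p - x) + t • (y - p) := by abel
  have hr := hrConvex p y (1 - t) t (by linarith) ht.le (by ring)
  rw [hu, hy, hp] at hr
  have h := (hmin (p + t • (y - p))).trans (add_le_add_right hr _)
  rw [hp, hux, mNormSq_add_smul hM, dotProduct_add, dotProduct_smul, smul_eq_mul] at h
  norm_cast at h
  refine nonneg_of_mul_nonneg_right ?_ ht
  linarith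

/-- Main descent chain: if `x̂` minimizes
`u ↦ ⟨∇φ(x) + (σ/θ)∇h(z), u⟩ + r(u) + (1/2)‖u − x‖²_{PT}`, then
`φ(x̂) ≤ −[r(x̂) − r(x*) + (1/2)‖x̂ − x*‖²_{PT}] − (σ/θ)⟨∇h(z), x̂ − x*⟩
− (1/2)‖x̂ − x‖²_{PT−Λ} + φ(x*) + (1/2)‖x − x*‖²_{PT}`. -/
theorem main_descent_chain {m q : ℕ}
    (A : Matrix (Fin q) (Fin m) ℝ) (b : Fin q → ℝ)
    (r : (Fin m → ℝ) → EReal)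
    (hrBot : ∀ u, r u ≠ ⊥) (hrTop : ∃ u, r u ≠ ⊤)
    (hrClosed : LowerSemicontinuous r)
    (hrConvex : ∀ u v : Fin m → ℝ, ∀ a c : ℝ, 0 ≤ a → 0 ≤ c → a + c = 1 →
      r (a • u + c • v) ≤ (a : EReal) * r u + (c : EReal) * r v)
    (φ : (Fin m → ℝ) → ℝ) (hφConvex : ConvexOn ℝ Set.univ φ)
    (gφ : (Fin m → ℝ) → Fin m → ℝ)
    (hφDiff : ∀ u, HasFDerivAt φ (dotCLM (gφ u)) u)
    (Λ : Matrix (Fin m) (Fin m) ℝ) (hΛpsd : Λ.PosSemidef)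
    (hφSmooth : ∀ x u : Fin m → ℝ, r x ≠ ⊤ → r u ≠ ⊤ →
      φ u ≤ φ x + gφ x ⬝ᵥ (u - x) + (1 / 2) * mNormSq Λ (u - x))
    (PT : Matrix (Fin m) (Fin m) ℝ) (hPT : PT.PosDef)
    (x z xstar : Fin m → ℝ) (σ θ : ℝ) (hθ : 0 < θ)
    (hxdom : r x ≠ ⊤) (hxstardom : r xstar ≠ ⊤)
    (xhat : Fin m → ℝ)
    (hmin : ∀ u : Fin m → ℝ,
      (((gφ x + (σ / θ) • gradH A b z) ⬝ᵥ xhat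
          + (1 / 2) * mNormSq PT (xhat - x) : ℝ) : EReal) + r xhat
        ≤ (((gφ x + (σ / θ) • gradH A b z) ⬝ᵥ u
          + (1 / 2) * mNormSq PT (u - x) : ℝ) : EReal) + r u) :
    (φ xhat : EReal)
      ≤ -(r xhat - r xstar + (((1 / 2) * mNormSq PT (xhat - xstar) : ℝ) : EReal))
        - (((σ / θ) * (gradH A b z ⬝ᵥ (xhat - xstar)) : ℝ) : EReal)
        - (((1 / 2) * mNormSq (PT - Λ) (xhat - x) : ℝ) : EReal)
        + (φ xstar : EReal)
        + (((1 / 2) * mNormSq PT (x - xstar) : ℝ) : EReal) := by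
  have hrx : r x = ((r x).toReal : EReal) := (EReal.coe_toReal hxdom (hrBot x)).symm
  have hrs : r xstar = ((r xstar).toReal : EReal) :=
    (EReal.coe_toReal hxstardom (hrBot xstar)).symm
  have hhat : r xhat ≠ ⊤ := by
    intro htop
    have h := hmin x
    rw [htop, hrx, EReal.coe_add_top, ← EReal.coe_add] at h
    exact EReal.coe_ne_top _ (top_le_iff.mp h)
  have hrh : r xhat = ((r xhat).toReal : EReal) := (EReal.coe_toReal hhat (hrBot xhat)).symm
  have hsymm : PT.IsSymm := by simpa [IsHermitian, IsSymm] using hPT.isHermitian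
  have hvar := prox_variational_inequality hrConvex hsymm hrs hrh hmin
  have hsmooth := hφSmooth x xhat hxdom hhat
  have hconv : φ x + gφ x ⬝ᵥ (xstar - x) ≤ φ xstar := hφConvex.add_fderiv_le (hφDiff x) xstar
  have hexp := mNormSq_add_smul hsymm (xhat - x) (xstar - xhat) 1
  rw [one_smul, sub_add_sub_cancel', ← neg_sub x xstar, ← neg_sub xhat xstar, mNormSq_neg,
    mNormSq_neg, neg_sub] at hexp
  rw [hrh, hrs]
  norm_cast
  rw [mNormSq_sub_matrix]
  simp only [add_dotProduct, smul_dotProduct, smul_eq_mul, dotProduct_sub] at *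
  linarith
end
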